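/- For m ∈ ℕ let a_m denote the number of isotopy equivalence classes of duplicate-free lists whose set of entries is exactly {1, …, m}. Then a_0 = 1 and, for every n ∈ ℕ, a_{n+1} = Σ_{k=0}^{n} a_k · a_{n−k}. -/

import Mathlib

/-- An elementary move on a duplicate-free list of natural numbers: transpose two
adjacent entries `x = i_j` and `y = i_{j+1}` for which there exists a later entry
`p = i_q` (with `q > j+1`) such that `x < p < y` or `x > p > y`. -/
def ElemMove (l l' : List ℕ) : Prop :=
  l.Nodup ∧ ∃ (a b : List ℕ) (x y : ℕ),
    l = a ++ x :: y :: b ∧ l' = a ++ y :: x :: b ∧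
    ∃ p ∈ b, (x < p ∧ p < y) ∨ (y < p ∧ p < x)

/-- Isotopy equivalence: the smallest equivalence relation generated by elementary moves. -/
def IsoEquiv : List ℕ → List ℕ → Prop := Relation.EqvGen ElemMove

/-- The set of duplicate-free lists of natural numbers whose set of entries is exactly
`{1, …, m}`. -/
def PermList (m : ℕ) : Set (List ℕ) :=
  {l | l.Nodup ∧ ∀ x, x ∈ l ↔ x ∈ Finset.Icc 1 m}

/-- `numClasses m` is the number of isotopy equivalence classes of duplicate-free lists
whose set of entries is exactly `{1, …, m}`. -/
noncomputable def numClasses (m : ℕ) : ℕ :=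
  Nat.card (Quot (fun l l' : PermList m => IsoEquiv l.1 l'.1))

namespace IsoProof
open BinaryTree

def ins (x : ℕ) : BinaryTree ℕ → BinaryTree ℕ
  | .nil => .node x .nil .nil
  | .node v l r =>
    if x < v then .node v (ins x l) r else if v < x then .node v l (ins x r) else .node v l r

def bst (l : List ℕ) : BinaryTree ℕ := l.foldr ins .nil

def ino : BinaryTree ℕ → List ℕ
  | .nil => []
  | .node v l r => ino l ++ v :: ino r

def wd : BinaryTree ℕ → List ℕ
  | .nil => []
  | .node v l r => wd l ++ (wd r ++ [v])

def lab : ℕ → BinaryTree Unit → BinaryTree ℕ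
  | _, .nil => .nil
  | a, .node _ l r => .node (a + l.numNodes) (lab a l) (lab (a + l.numNodes + 1) r)

def shape : BinaryTree ℕ → BinaryTree Unit
  | .nil => .nil
  | .node _ l r => .node () (shape l) (shape r)

def IsB (t : BinaryTree ℕ) : Prop := (ino t).Pairwise (· < ·)

theorem isB_node (v : ℕ) (l r : BinaryTree ℕ) :
    IsB (.node v l r) ↔ IsB l ∧ IsB r ∧ (∀ x ∈ ino l, x < v) ∧ (∀ x ∈ ino r, v < x) := by
  simp only [IsB, ino, List.pairwise_append, List.pairwise_cons, List.mem_cons]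
  constructor
  · rintro ⟨h1, ⟨h2, h3⟩, h4⟩
    exact ⟨h1, h3, fun x hx => h4 x hx v (Or.inl rfl), h2⟩
  · rintro ⟨h1, h2, h3, h4⟩
    refine ⟨h1, ⟨h4, h2⟩, ?_⟩
    rintro a ha b (rfl | hb)
    · exact h3 a ha
    · exact (h3 a ha).trans (h4 b hb)

theorem mem_ins (x y : ℕ) (t : BinaryTree ℕ) : y ∈ ino (ins x t) ↔ y = x ∨ y ∈ ino t := by
  induction t with
  | nil => simp [ins, ino]
  | node v l r hl hr =>
    simp only [ins]
    split_ifs with h1 h2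
    · simp only [ino, List.mem_append, List.mem_cons, hl]; tauto
    · simp only [ino, List.mem_append, List.mem_cons, hr]; tauto
    · have : x = v := by omega
      subst this
      simp only [ino, List.mem_append, List.mem_cons]; tauto

theorem isB_ins (x : ℕ) (t : BinaryTree ℕ) (h : IsB t) : IsB (ins x t) := by
  induction t with
  | nil => simp [ins, ino, IsB]
  | node v l r hl hr =>
    have h' := (isB_node _ _ _).1 h
    obtain ⟨a, b, c, d⟩ := h'
    simp only [ins]
    split_ifs with h1 h2
    · refine (isB_node _ _ _).2 ⟨hl a, b, ?_, d⟩
      intro y hy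
      rcases (mem_ins _ _ _).1 hy with rfl | hy
      · exact h1
      · exact c y hy
    · refine (isB_node _ _ _).2 ⟨a, hr b, c, ?_⟩
      intro y hy
      rcases (mem_ins _ _ _).1 hy with rfl | hy
      · exact h2
      · exact d y hy
    · exact h

theorem isB_bst (l : List ℕ) : IsB (bst l) := by
  induction l with
  | nil => simp [bst, ino, IsB]
  | cons x l ih => exact isB_ins _ _ ih

theorem mem_bst (l : List ℕ) (y : ℕ) : y ∈ ino (bst l) ↔ y ∈ l := by
  induction l with
  | nil => simp [bst, ino]
  | cons x l ih =>
    have : bst (x :: l) = ins x (bst l) := rfl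
    rw [this, mem_ins, ih, List.mem_cons]

theorem ins_comm (x y p : ℕ) (hx : x < p) (hy : p < y) (t : BinaryTree ℕ) (h : IsB t)
    (hp : p ∈ ino t) : ins x (ins y t) = ins y (ins x t) := by
  induction t with
  | nil => simp [ino] at hp
  | node v l r hl hr =>
    obtain ⟨a, b, c, d⟩ := (isB_node _ _ _).1 h
    simp only [ino, List.mem_append, List.mem_cons] at hp
    rcases hp with hp | rfl | hp
    · have := c p hp
      have hl' := hl a hp
      rcases lt_trichotomy y v with h1 | h1 | h1
      · have h2 : x < v := by omega
        simp [ins, h1, h2, hl']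
      · have h2 : x < v := by omega
        simp [ins, h1, h2]
      · have h2 : x < v := by omega
        have h3 : ¬ y < v := by omega
        simp [ins, h1, h2, h3]
    · have h3 : ¬ y < p := by omega
      simp [ins, hx, hy, h3]
    · have := d p hp
      have hr' := hr b hp
      have h1 : v < y := by omega
      have h3 : ¬ y < v := by omega
      rcases lt_trichotomy x v with h2 | h2 | h2
      · simp [ins, h1, h2, h3]
      · simp [ins, h1, h2, h3]
      · have h4 : ¬ x < v := by omega
        simp [ins, h1, h2, h3, h4, hr']

theorem bst_append (a b : List ℕ) : bst (a ++ b) = a.foldr ins (bst b) := by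
  simp [bst]

theorem bst_move {l l' : List ℕ} (h : ElemMove l l') : bst l = bst l' := by
  obtain ⟨-, a, b, x, y, rfl, rfl, p, hp, h⟩ := h
  rw [bst_append, bst_append]
  congr 1
  change ins x (ins y (bst b)) = ins y (ins x (bst b))
  have hp' := (mem_bst b p).2 hp
  rcases h with h | h
  · exact ins_comm _ _ _ h.1 h.2 _ (isB_bst b) hp'
  · exact (ins_comm _ _ _ h.1 h.2 _ (isB_bst b) hp').symm

theorem bst_iso {l l' : List ℕ} (h : IsoEquiv l l') : bst l = bst l' := by
  induction h with
  | rel _ _ h => exact bst_move h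
  | refl => rfl
  | symm _ _ _ ih => exact ih.symm
  | trans _ _ _ _ _ h1 h2 => exact h1.trans h2

theorem move_perm {l l' : List ℕ} (h : ElemMove l l') : l.Perm l' := by
  obtain ⟨-, a, b, x, y, rfl, rfl, -⟩ := h
  exact List.Perm.append_left a (List.Perm.swap y x b)

theorem iso_perm {l l' : List ℕ} (h : IsoEquiv l l') : l.Perm l' := by
  induction h with
  | rel _ _ h => exact move_perm h
  | refl => rfl
  | symm _ _ _ ih => exact ih.symm
  | trans _ _ _ _ _ h1 h2 => exact h1.trans h2

theorem iso_ctx (c d : List ℕ) {l l' : List ℕ} (h : IsoEquiv l l') (hn : (c ++ (l ++ d)).Nodup) :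
    IsoEquiv (c ++ (l ++ d)) (c ++ (l' ++ d)) := by
  induction h with
  | rel l l' h =>
    obtain ⟨-, a, b, x, y, rfl, rfl, p, hp, h⟩ := h
    refine Relation.EqvGen.rel _ _ ⟨hn, c ++ a, b ++ d, x, y, by simp, by simp, p, by simp [hp], h⟩
  | refl => exact Relation.EqvGen.refl _
  | symm l l' h ih =>
    refine Relation.EqvGen.symm _ _ (ih ?_)
    exact ((((iso_perm h).append_right d).append_left c).nodup_iff).2 hn
  | trans l m k h1 h2 i1 i2 =>
    refine Relation.EqvGen.trans _ _ _ (i1 hn) (i2 ?_)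
    exact ((((iso_perm h1).append_right d).append_left c).nodup_iff).1 hn

theorem wd_perm (t : BinaryTree ℕ) : (wd t).Perm (ino t) := by
  induction t with
  | nil => rfl
  | node v l r hl hr =>
    simp only [wd, ino]
    exact hl.append ((List.perm_append_singleton v (wd r)).trans (hr.cons v))

theorem isB_nodup {t : BinaryTree ℕ} (h : IsB t) : (ino t).Nodup :=
  h.imp (fun h => ne_of_lt h)

theorem wd_nodup {t : BinaryTree ℕ} (h : IsB t) : (wd t).Nodup :=
  (wd_perm t).nodup_iff.2 (isB_nodup h)

theorem slide (x v : ℕ) (hv : v < x) (l d : List ℕ) (hl : ∀ y ∈ l, y < v) (hd : v ∈ d)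
    (hn : (x :: (l ++ d)).Nodup) : IsoEquiv (x :: (l ++ d)) (l ++ x :: d) := by
  induction l with
  | nil => exact Relation.EqvGen.refl _
  | cons y l ih =>
    have hm : ElemMove (x :: (y :: l ++ d)) (y :: x :: (l ++ d)) :=
      ⟨hn, [], l ++ d, x, y, rfl, rfl, v, by simp [hd], Or.inr ⟨hl y (by simp), hv⟩⟩
    have hn2 := (move_perm hm).nodup_iff.1 hn
    have h2 := ih (fun z hz => hl z (by simp [hz])) hn2.of_cons
    have h3 := iso_ctx [y] [] h2 (by simpa using hn2)
    simp only [List.append_nil, List.singleton_append] at h3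
    exact Relation.EqvGen.trans _ _ _ (Relation.EqvGen.rel _ _ hm) h3

theorem wd_ins (x : ℕ) (t : BinaryTree ℕ) (h : IsB t) (hx : x ∉ ino t) :
    IsoEquiv (x :: wd t) (wd (ins x t)) := by
  induction t with
  | nil => exact Relation.EqvGen.refl _
  | node v l r hl hr =>
    have hn : (x :: wd (.node v l r)).Nodup :=
      List.nodup_cons.2 ⟨fun h' => hx ((wd_perm _).mem_iff.1 h'), wd_nodup h⟩
    obtain ⟨a, b, c, d⟩ := (isB_node _ _ _).1 h
    simp only [ino, List.mem_append, List.mem_cons, not_or] at hx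
    obtain ⟨x1, x2, x3⟩ := hx
    simp only [wd] at hn
    simp only [ins]
    split_ifs with h1 h2
    · exact iso_ctx [] (wd r ++ [v]) (hl a x1) hn
    · have s := slide x v h2 (wd l) (wd r ++ [v]) (fun y hy => c y ((wd_perm _).mem_iff.1 hy))
        (by simp) hn
      exact Relation.EqvGen.trans _ _ _ s
        (iso_ctx (wd l) [v] (hr b x3) ((iso_perm s).nodup_iff.1 hn))
    · omega

theorem iso_wd (l : List ℕ) (h : l.Nodup) : IsoEquiv l (wd (bst l)) := by
  induction l with
  | nil => exact Relation.EqvGen.refl _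
  | cons x l ih =>
    have h1 := iso_ctx [x] [] (ih h.of_cons) (by simpa using h)
    simp only [List.append_nil, List.singleton_append] at h1
    refine Relation.EqvGen.trans _ _ _ h1 (wd_ins x (bst l) (isB_bst l) ?_)
    rw [mem_bst]
    exact (List.nodup_cons.1 h).1

theorem foldr_left (v : ℕ) (a b : BinaryTree ℕ) (l : List ℕ) (h : ∀ y ∈ l, y < v) :
    l.foldr ins (.node v a b) = .node v (l.foldr ins a) b := by
  induction l with
  | nil => rfl
  | cons x l ih =>
    simp [ih (fun z hz => h z (by simp [hz])), ins, h x (by simp)]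

theorem foldr_right (v : ℕ) (a b : BinaryTree ℕ) (l : List ℕ) (h : ∀ y ∈ l, v < y) :
    l.foldr ins (.node v a b) = .node v a (l.foldr ins b) := by
  induction l with
  | nil => rfl
  | cons x l ih =>
    have := h x (by simp)
    simp [ih (fun z hz => h z (by simp [hz])), ins, this, this.le]

theorem bst_wd (t : BinaryTree ℕ) (h : IsB t) : bst (wd t) = t := by
  induction t with
  | nil => rfl
  | node v l r hl hr =>
    obtain ⟨a, b, c, d⟩ := (isB_node _ _ _).1 h
    simp only [wd]
    rw [bst_append, bst_append]
    change (wd l).foldr ins ((wd r).foldr ins (.node v .nil .nil)) = _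
    rw [foldr_right _ _ _ _ (fun y hy => d y ((wd_perm _).mem_iff.1 hy)),
      foldr_left _ _ _ _ (fun y hy => c y ((wd_perm _).mem_iff.1 hy))]
    change BinaryTree.node v (bst (wd l)) (bst (wd r)) = _
    rw [hl a, hr b]

theorem ino_length (t : BinaryTree ℕ) : (ino t).length = (shape t).numNodes := by
  induction t with
  | nil => rfl
  | node v l r hl hr => simp [ino, shape, hl, hr]; omega

theorem ino_lab (s : BinaryTree Unit) (a : ℕ) : ino (lab a s) = List.range' a s.numNodes := by
  induction s generalizing a with
  | nil => rfl
  | node v l r hl hr =>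
    simp only [lab, ino, hl, hr, numNodes]
    rw [← List.range'_succ, List.range'_append_1, Nat.add_assoc]

theorem shape_lab (s : BinaryTree Unit) (a : ℕ) : shape (lab a s) = s := by
  induction s generalizing a with
  | nil => rfl
  | node v l r hl hr => simp [lab, shape, hl, hr]

theorem lab_shape (t : BinaryTree ℕ) (a n : ℕ) (h : ino t = List.range' a n) :
    lab a (shape t) = t := by
  induction t generalizing a n with
  | nil => rfl
  | node v l r hl hr =>
    have hlen := congrArg List.length h
    simp only [ino, List.length_append, List.length_cons, List.length_range'] at hlen
    have e : List.range' a n = List.range' a (ino l).length ++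
        (a + (ino l).length) :: List.range' (a + (ino l).length + 1) (ino r).length := by
      rw [← List.range'_succ, List.range'_append_1, ← hlen]
    rw [e, ino] at h
    obtain ⟨h1, h2⟩ := List.append_inj h (by simp)
    obtain ⟨h3, h4⟩ := List.cons.inj h2
    simp only [shape, lab, ← ino_length]
    rw [hl _ _ h1, hr _ _ h4, ← h3]

theorem range'_sorted (a n : ℕ) : (List.range' a n).Pairwise (· < ·) :=
  List.pairwise_lt_range'

theorem ino_bst_perm (m : ℕ) (l : List ℕ) (h : l ∈ PermList m) :
    ino (bst l) = List.range' 1 m := by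
  have hp : (ino (bst l)).Perm (List.range' 1 m) := by
    rw [List.perm_ext_iff_of_nodup (isB_nodup (isB_bst l)) List.nodup_range']
    intro x
    rw [mem_bst, h.2, Finset.mem_Icc, List.mem_range'_1]
    omega
  exact hp.eq_of_pairwise (fun a b _ _ h1 h2 => absurd h1 h2.asymm) (isB_bst l)
    (range'_sorted 1 m)

theorem numClasses_eq (m : ℕ) : numClasses m = catalan m := by
  have hsh : ∀ l ∈ PermList m, shape (bst l) ∈ treesOfNumNodesEq m := by
    intro l hl
    rw [mem_treesOfNumNodesEq, ← ino_length, ino_bst_perm m l hl, List.length_range']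
  rw [← treesOfNumNodesEq_card_eq_catalan, ← Nat.card_eq_finsetCard]
  let f : Quot (fun l l' : PermList m => IsoEquiv l.1 l'.1) → treesOfNumNodesEq m :=
    Quot.lift (fun l => ⟨shape (bst l.1), hsh l.1 l.2⟩)
      (fun l l' h => Subtype.ext (congrArg shape (bst_iso h)))
  refine Nat.card_eq_of_bijective f ⟨?_, ?_⟩
  · rintro ⟨l⟩ ⟨l'⟩ h
    have h1 : shape (bst l.1) = shape (bst l'.1) := congrArg Subtype.val h
    have h2 : bst l.1 = bst l'.1 := by
      rw [← lab_shape _ _ _ (ino_bst_perm m l.1 l.2), h1,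
        lab_shape _ _ _ (ino_bst_perm m l'.1 l'.2)]
    refine Quot.sound ?_
    refine Relation.EqvGen.trans _ _ _ (iso_wd l.1 l.2.1) ?_
    rw [h2]
    exact Relation.EqvGen.symm _ _ (iso_wd l'.1 l'.2.1)
  · rintro ⟨s, hs⟩
    rw [mem_treesOfNumNodesEq] at hs
    have hB : IsB (lab 1 s) := by
      rw [IsB, ino_lab]
      exact range'_sorted _ _
    refine ⟨Quot.mk _ ⟨wd (lab 1 s), wd_nodup hB, ?_⟩, ?_⟩
    · intro x
      rw [(wd_perm _).mem_iff, ino_lab, Finset.mem_Icc, List.mem_range'_1, hs]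
      omega
    · refine Subtype.ext ?_
      change shape (bst (wd (lab 1 s))) = s
      rw [bst_wd _ hB, shape_lab]

end IsoProof

/-- The numbers of isotopy equivalence classes satisfy the Catalan recurrence:
`a_0 = 1` and `a_{n+1} = Σ_{k=0}^{n} a_k · a_{n−k}`. -/
theorem numClasses_catalan_recurrence :
    numClasses 0 = 1 ∧
      ∀ n : ℕ, numClasses (n + 1) = ∑ k ∈ Finset.range (n + 1), numClasses k * numClasses (n - k) := by
  refine ⟨by simp [IsoProof.numClasses_eq], fun n => ?_⟩
  simp only [IsoProof.numClasses_eq]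
  rw [catalan_succ, Finset.sum_range]
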